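/- arXiv:1706.09949 — 2 statements merged into one kernel-verified Lean document; each statement's English description precedes it below -/
import Mathlib

section
/- Let π be an arrangement of n ≤ wd objects in which stack w+1 is empty, and let o be an object lying in stack x. Then there exists a sequence of at most 2d + 2 permissible pop-and-push actions transforming π into an arrangement in which o is the top (minimal-depth) object of stack x, every object other than o lies in the same stack as in π, and the relative order of the objects other than o within each stack is unchanged. -/
/-- An arrangement of `n` objects into `k` stacks of capacity `d`.
Depths are 0-based: Fin index `j` corresponds to depth `j+1`; index `0` is the top,
index `d-1` is the bottom (depth `d`). The occupied depths of every stack form a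
contiguous block containing the bottom. -/
structure Arrangement (n k d : ℕ) where
  pos : Fin n → Fin k × Fin d
  inj : Function.Injective pos
  contig : ∀ o : Fin n, ∀ j : Fin d, (pos o).2 ≤ j → ∃ o', pos o' = ((pos o).1, j)

/-- A permissible pop-and-push action: the top (minimal-depth) object `o` of a nonempty
stack is removed and pushed onto a different stack; all other objects stay put.
(Validity of the resulting `Arrangement` forces `o` to land on top of a stack that had
fewer than `d` objects.) -/
def Step {n k d : ℕ} (π π' : Arrangement n k d) : Prop :=
  ∃ o : Fin n,
    (π'.pos o).1 ≠ (π.pos o).1 ∧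
    (∀ o' : Fin n, o' ≠ o → (π.pos o').1 = (π.pos o).1 → (π.pos o).2 < (π.pos o').2) ∧
    (∀ o' : Fin n, o' ≠ o → π'.pos o' = π.pos o')

/-- `Reach π π' m`: the arrangement `π'` can be obtained from `π` by a sequence of
exactly `m` permissible pop-and-push actions. -/
def Reach {n k d : ℕ} (π π' : Arrangement n k d) (m : ℕ) : Prop :=
  ∃ f : ℕ → Arrangement n k d, f 0 = π ∧ f m = π' ∧ ∀ t, t < m → Step (f t) (f (t + 1))

theorem Reach.refl {n k d : ℕ} (π : Arrangement n k d) : Reach π π 0 :=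
  ⟨fun _ => π, rfl, rfl, fun _ h => absurd h (Nat.not_lt_zero _)⟩

theorem Step.reach {n k d : ℕ} {π ρ : Arrangement n k d} (h : Step π ρ) : Reach π ρ 1 := by
  refine ⟨fun t => if t = 0 then π else ρ, by simp, by simp, fun t ht => ?_⟩
  obtain rfl : t = 0 := by omega
  simpa using h

theorem Reach.trans {n k d m l : ℕ} {π ρ σ : Arrangement n k d}
    (h₁ : Reach π ρ m) (h₂ : Reach ρ σ l) : Reach π σ (m + l) := by
  obtain ⟨f, f0, fm, hf⟩ := h₁
  obtain ⟨g, g0, gl, hg⟩ := h₂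
  refine ⟨fun t => if t ≤ m then f t else g (t - m), by simpa using f0, ?_, fun t ht => ?_⟩
  · rcases Nat.eq_zero_or_pos l with rfl | hl
    · simp [fm, ← gl, g0]
    · simp [gl, hl.ne']
  · rcases lt_trichotomy t m with h | rfl | h
    · simpa [h.le, Nat.succ_le_of_lt h] using hf t h
    · simpa [fm, ← g0] using hg 0 (by omega)
    · have h₁ : ¬ t ≤ m := by omega
      have h₂ : ¬ t + 1 ≤ m := by omega
      have h₃ : t + 1 - m = t - m + 1 := by omega
      simpa only [h₁, h₂, h₃, if_false] using hg (t - m) (by omega)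

namespace Arrangement

variable {n k d : ℕ}

/-- The objects lying in stack `j`. -/
def stack (π : Arrangement n k d) (j : Fin k) : Finset (Fin n) :=
  Finset.univ.filter fun o => (π.pos o).1 = j

@[simp]
theorem mem_stack {π : Arrangement n k d} {j : Fin k} {o : Fin n} :
    o ∈ π.stack j ↔ (π.pos o).1 = j := by
  simp [stack]

theorem depth_injOn (π : Arrangement n k d) (j : Fin k) :
    Set.InjOn (fun o => (π.pos o).2) (π.stack j) := by
  intro a ha b hb hab
  rw [Finset.mem_coe, mem_stack] at ha hb
  exact π.inj (Prod.ext (ha.trans hb.symm) hab)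

theorem card_stack_le (π : Arrangement n k d) (j : Fin k) : (π.stack j).card ≤ d := by
  rw [← Finset.card_image_of_injOn (π.depth_injOn j)]
  exact (Finset.card_le_univ _).trans_eq (Fintype.card_fin d)

theorem exists_free_slot {π : Arrangement n k d} {j : Fin k} (h : (π.stack j).card < d) :
    ∃ s : Fin d, (∀ o, π.pos o ≠ (j, s)) ∧ ∀ t, s < t → ∃ o, π.pos o = (j, t) := by
  classical
  have hne : (Finset.univ.filter fun s : Fin d => ∀ o, π.pos o ≠ (j, s)).Nonempty := by
    by_contra hfull
    rw [Finset.not_nonempty_iff_eq_empty, Finset.filter_eq_empty_iff] at hfull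
    have hfull' : ∀ s : Fin d, ∃ o, π.pos o = (j, s) := by
      intro s
      simpa using hfull (Finset.mem_univ s)
    choose f hf using hfull'
    have hf_inj : Function.Injective f := by
      intro s t hst
      have := (hf s).symm.trans ((congrArg π.pos hst).trans (hf t))
      exact (Prod.ext_iff.1 this).2
    have hle : (Finset.univ.image f).card ≤ (π.stack j).card := by
      apply Finset.card_le_card
      intro o ho
      obtain ⟨s, -, rfl⟩ := Finset.mem_image.1 ho
      simp [hf]
    rw [Finset.card_image_of_injective _ hf_inj, Finset.card_univ, Fintype.card_fin] at hle
    omega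
  refine ⟨_, (Finset.mem_filter.1 (Finset.max'_mem _ hne)).2, fun t ht => ?_⟩
  by_contra! hfree
  exact absurd (Finset.le_max' _ t (by simpa using hfree)) (not_le.2 ht)

/-- The top object of a stack can be pushed onto any other stack that is not full. -/
theorem exists_step {π : Arrangement n k d} {o : Fin n} {j : Fin k} (hj : (π.pos o).1 ≠ j)
    (htop : ∀ o', o' ≠ o → (π.pos o').1 = (π.pos o).1 → (π.pos o).2 < (π.pos o').2)
    (hroom : (π.stack j).card < d) :
    ∃ π' : Arrangement n k d, Step π π' ∧ (π'.pos o).1 = j ∧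
      (∀ o', o' ≠ o → π'.pos o' = π.pos o') ∧
      ∀ o', o' ≠ o → (π.pos o').1 = j → (π'.pos o).2 < (π.pos o').2 := by
  classical
  obtain ⟨s, hs, hbelow⟩ := exists_free_slot hroom
  have hdeep : ∀ o', (π.pos o').1 = j → s < (π.pos o').2 := by
    intro o' ho'
    by_contra! hle
    obtain ⟨o'', h⟩ := π.contig o' s hle
    exact hs o'' (h.trans (by rw [ho']))
  have hself : Function.update π.pos o (j, s) o = (j, s) := Function.update_self ..
  have hother : ∀ o', o' ≠ o → Function.update π.pos o (j, s) o' = π.pos o' :=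
    fun o' h => Function.update_of_ne h ..
  refine ⟨⟨Function.update π.pos o (j, s), ?_, ?_⟩, ⟨o, ?_, htop, hother⟩, ?_, hother, ?_⟩
  · intro a b hab
    by_cases ha : a = o <;> by_cases hb : b = o
    · rw [ha, hb]
    · subst ha
      rw [hself, hother b hb] at hab
      exact absurd hab.symm (hs b)
    · subst hb
      rw [hself, hother a ha] at hab
      exact absurd hab (hs a)
    · rw [hother a ha, hother b hb] at hab
      exact π.inj hab
  · intro a t hat
    by_cases ha : a = o
    · subst ha
      rw [hself] at hat ⊢
      rcases eq_or_lt_of_le hat with rfl | hlt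
      · exact ⟨a, hself⟩
      · obtain ⟨b, hb⟩ := hbelow t hlt
        have hba : b ≠ a := by
          rintro rfl
          exact hj (by rw [hb])
        exact ⟨b, (hother b hba).trans hb⟩
    · rw [hother a ha] at hat ⊢
      obtain ⟨b, hb⟩ := π.contig a t hat
      have hbo : b ≠ o := by
        rintro rfl
        have hlt := htop a ha (by rw [hb])
        rw [hb] at hlt
        exact absurd hat (not_le.2 hlt)
      exact ⟨b, (hother b hbo).trans hb⟩
  · simpa [hself] using hj.symm
  · simp
  · intro o' _ h
    simpa [hself] using hdeep o' h

/-- The upper part `A` of stack `x` can be moved onto stack `e` in `#A` actions, which reverses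
its order. -/
theorem exists_reach_transfer {x e : Fin k} (hxe : x ≠ e) :
    ∀ (A : Finset (Fin n)) (π : Arrangement n k d), A ⊆ π.stack x →
      (∀ a ∈ A, ∀ b ∉ A, (π.pos b).1 = x → (π.pos a).2 < (π.pos b).2) →
      (π.stack e).card + A.card ≤ d →
      ∃ π' : Arrangement n k d, Reach π π' A.card ∧
        (∀ a ∈ A, (π'.pos a).1 = e) ∧
        (∀ b ∉ A, π'.pos b = π.pos b) ∧
        (∀ a ∈ A, ∀ b ∈ A, (π.pos a).2 < (π.pos b).2 → (π'.pos b).2 < (π'.pos a).2) ∧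
        (∀ a ∈ A, ∀ b ∉ A, (π.pos b).1 = e → (π'.pos a).2 < (π.pos b).2) := by
  classical
  intro A
  induction hm : A.card generalizing A with
  | zero =>
    intro π _ _ _
    obtain rfl := Finset.card_eq_zero.1 hm
    exact ⟨π, Reach.refl π, by simp⟩
  | succ m ih =>
    intro π hAx hup hroom
    obtain ⟨a, ha, hmin⟩ := A.exists_min_image (fun o => (π.pos o).2)
      (Finset.card_pos.1 (by omega))
    have hax := mem_stack.1 (hAx ha)
    have hlt : ∀ b ∈ A, b ≠ a → (π.pos a).2 < (π.pos b).2 := fun b hb hba =>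
      lt_of_le_of_ne (hmin b hb) fun h =>
        hba (π.depth_injOn x (hAx hb) (hAx ha) h.symm)
    obtain ⟨ρ, hstep, hρa, hρ, hρtop⟩ := exists_step (π := π) (o := a) (j := e)
      (by rwa [hax]) (by
        intro b hba hbx
        by_cases hb : b ∈ A
        · exact hlt b hb hba
        · exact hup a ha b hb (hbx.trans hax)) (by omega)
    have hcard : (A.erase a).card = m := by rw [Finset.card_erase_of_mem ha]; omega
    have hstack : (ρ.stack e).card ≤ (π.stack e).card + 1 := by
      refine (Finset.card_le_card (t := insert a (π.stack e)) fun b hb => ?_).trans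
        (Finset.card_insert_le _ _)
      by_cases hba : b = a
      · simp [hba]
      · rw [mem_stack, hρ b hba] at hb
        simp [hb]
    obtain ⟨σ, hreach, hσe, hσ, hσrev, hσtop⟩ := ih (A.erase a) hcard ρ
      (by
        intro b hb
        obtain ⟨hba, hb⟩ := Finset.mem_erase.1 hb
        rw [mem_stack, hρ b hba]
        exact mem_stack.1 (hAx hb))
      (by
        intro b hb c hc hcx
        obtain ⟨hba, hb⟩ := Finset.mem_erase.1 hb
        have hca : c ≠ a := by
          rintro rfl
          exact hxe (hcx.symm.trans hρa)
        rw [hρ c hca] at hcx ⊢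
        rw [hρ b hba]
        exact hup b hb c (fun h => hc (Finset.mem_erase.2 ⟨hca, h⟩)) hcx)
      (by omega)
    have hσa : σ.pos a = ρ.pos a := hσ a (by simp)
    refine ⟨σ, ?_, ?_, ?_, ?_, ?_⟩
    · rw [add_comm]
      exact hstep.reach.trans hreach
    · intro b hb
      by_cases hba : b = a
      · rw [hba, hσa, hρa]
      · exact hσe b (Finset.mem_erase.2 ⟨hba, hb⟩)
    · intro b hb
      rw [hσ b (fun h => hb (Finset.mem_of_mem_erase h)), hρ b (fun h => hb (h ▸ ha))]
    · intro b hb c hc hbc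
      have hca : c ≠ a := by
        rintro rfl
        exact absurd (hmin b hb) (not_le.2 hbc)
      have hc' := Finset.mem_erase.2 ⟨hca, hc⟩
      by_cases hba : b = a
      · rw [hba, hσa]
        exact hσtop c hc' a (by simp) hρa
      · exact hσrev b (Finset.mem_erase.2 ⟨hba, hb⟩) c hc' (by rwa [hρ b hba, hρ c hca])
    · intro b hb c hc hce
      have hca : c ≠ a := fun h => hc (h ▸ ha)
      by_cases hba : b = a
      · rw [hba, hσa]
        exact hρtop c hca hce
      · have := hσtop b (Finset.mem_erase.2 ⟨hba, hb⟩) c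
          (fun h => hc (Finset.mem_of_mem_erase h)) (by rwa [hρ c hca])
        rwa [hρ c hca] at this

/-- An object `o` can be brought to the top of its stack with the help of a stack `y` that has a
free slot and a stack `e` that holds at most one object. -/
theorem exists_reach_top_of_room (π : Arrangement n k d) (o : Fin n) {y e : Fin k}
    (hy : (π.pos o).1 ≠ y) (he : (π.pos o).1 ≠ e) (hye : y ≠ e)
    (hroom : (π.stack y).card < d) (hcard : (π.stack e).card ≤ 1) :
    ∃ m ≤ 2 * d, ∃ π' : Arrangement n k d, Reach π π' m ∧ (π'.pos o).1 = (π.pos o).1 ∧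
      (∀ o', o' ≠ o → (π'.pos o').1 = (π'.pos o).1 → (π'.pos o).2 < (π'.pos o').2) ∧
      (∀ o', o' ≠ o → (π'.pos o').1 = (π.pos o').1) ∧
      (∀ o₁ o₂, o₁ ≠ o → o₂ ≠ o → (π.pos o₁).1 = (π.pos o₂).1 →
        (π.pos o₁).2 < (π.pos o₂).2 → (π'.pos o₁).2 < (π'.pos o₂).2) := by
  classical
  set x := (π.pos o).1 with hx
  set A := (π.stack x).filter fun a => (π.pos a).2 < (π.pos o).2 with hA
  have memA : ∀ a, a ∈ A ↔ (π.pos a).1 = x ∧ (π.pos a).2 < (π.pos o).2 := by simp [hA]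
  have hoA : o ∉ A := by simp [memA]
  have hAx : A ⊆ π.stack x := Finset.filter_subset _ _
  have hAd : A.card + 1 ≤ d := by
    rw [← Finset.card_insert_of_notMem hoA]
    exact (Finset.card_le_card
      (Finset.insert_subset (mem_stack.2 hx.symm) hAx)).trans (π.card_stack_le x)
  obtain ⟨π₁, r₁, he₁, hp₁, hrev₁, htop₁⟩ := exists_reach_transfer he A π hAx
    (by
      intro a ha b hb hbx
      have : ¬ (π.pos b).2 < (π.pos o).2 := fun h => hb ((memA b).2 ⟨hbx, h⟩)
      exact ((memA a).1 ha).2.trans_le (not_lt.1 this))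
    (by omega)
  have ho₁ : π₁.pos o = π.pos o := hp₁ o hoA
  obtain ⟨π₂, s₂, hy₂, hp₂, htop₂⟩ := exists_step (π := π₁) (o := o) (j := y) (by rwa [ho₁])
    (by
      intro b hbo hbx
      rw [ho₁] at hbx ⊢
      by_cases hb : b ∈ A
      · exact absurd (hbx.symm.trans (he₁ b hb)) he
      · rw [hp₁ b hb] at hbx ⊢
        refine lt_of_le_of_ne (not_lt.1 fun h => hb ((memA b).2 ⟨hbx, h⟩)) fun h => ?_
        exact hbo (π.inj (Prod.ext hbx h.symm)))
    (by
      refine (Finset.card_le_card fun b hb => ?_).trans_lt hroom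
      rw [mem_stack] at hb ⊢
      by_cases hbA : b ∈ A
      · exact absurd (hb.symm.trans (he₁ b hbA)) hye
      · rwa [hp₁ b hbA] at hb)
  have hne : ∀ a ∈ A, a ≠ o := fun a ha h => hoA (h ▸ ha)
  have hp₂' : ∀ b ∉ A, b ≠ o → π₂.pos b = π.pos b := fun b hb hbo =>
    (hp₂ b hbo).trans (hp₁ b hb)
  obtain ⟨π₃, r₃, he₃, hp₃, hrev₃, htop₃⟩ := exists_reach_transfer he.symm A π₂
    (by
      intro a ha
      rw [mem_stack, hp₂ a (hne a ha)]
      exact he₁ a ha)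
    (by
      intro a ha b hb hbe
      have hbo : b ≠ o := by
        rintro rfl
        exact hye (hy₂.symm.trans hbe)
      rw [hp₂' b hb hbo] at hbe ⊢
      rw [hp₂ a (hne a ha)]
      exact htop₁ a ha b hb hbe)
    (by
      rw [← Finset.card_union_of_disjoint]
      · refine (Finset.card_le_card (Finset.union_subset (fun b hb => ?_) hAx)).trans
          (π.card_stack_le x)
        rw [mem_stack] at hb ⊢
        by_cases hbo : b = o
        · rw [hbo]
        · by_cases hbA : b ∈ A
          · exact ((memA b).1 hbA).1
          · rwa [hp₂' b hbA hbo] at hb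
      · rw [Finset.disjoint_right]
        intro a ha hax
        rw [mem_stack, hp₂ a (hne a ha), he₁ a ha] at hax
        exact he hax.symm)
  have ho₃ : π₃.pos o = π₂.pos o := hp₃ o hoA
  have hp₃' : ∀ b ∉ A, b ≠ o → π₃.pos b = π.pos b := fun b hb hbo =>
    (hp₃ b hb).trans (hp₂' b hb hbo)
  have hstack₃ : ∀ b, b ≠ o → (π₃.pos b).1 = (π.pos b).1 := by
    intro b hbo
    by_cases hb : b ∈ A
    · rw [he₃ b hb, ((memA b).1 hb).1]
    · rw [hp₃' b hb hbo]
  obtain ⟨π₄, s₄, hx₄, hp₄, htop₄⟩ := exists_step (π := π₃) (o := o) (j := x)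
    (by rw [ho₃, hy₂]; exact hy.symm)
    (by
      intro b hbo hby
      rw [ho₃, hy₂] at hby
      rw [ho₃]
      have hb : b ∉ A := fun hb => hy ((he₃ b hb).symm.trans hby)
      have hb₁ : π₃.pos b = π₁.pos b := (hp₃ b hb).trans (hp₂ b hbo)
      rw [hb₁] at hby ⊢
      exact htop₂ b hbo hby)
    (by
      refine (Finset.card_lt_card (t := π.stack x) ?_).trans_le (π.card_stack_le x)
      refine Finset.ssubset_iff_subset_ne.2 ⟨fun b hb => ?_, fun h => ?_⟩
      · rw [mem_stack] at hb ⊢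
        by_cases hbo : b = o
        · rw [hbo]
        · rwa [hstack₃ b hbo] at hb
      · have : o ∈ π₃.stack x := h ▸ mem_stack.2 hx.symm
        rw [mem_stack, ho₃, hy₂] at this
        exact hy this.symm)
  refine ⟨A.card + 1 + A.card + 1, by omega, π₄,
    ((r₁.trans s₂.reach).trans r₃).trans s₄.reach, hx₄, ?_, ?_, ?_⟩
  · intro b hbo hbx
    rw [hp₄ b hbo] at hbx ⊢
    exact htop₄ b hbo (hbx.trans hx₄)
  · intro b hbo
    rw [hp₄ b hbo, hstack₃ b hbo]
  · intro b c hbo hco hbc hlt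
    rw [hp₄ b hbo, hp₄ c hco]
    by_cases hb : b ∈ A <;> by_cases hc : c ∈ A
    · refine hrev₃ c hc b hb ?_
      rw [hp₂ b hbo, hp₂ c hco]
      exact hrev₁ b hb c hc hlt
    · have := htop₃ b hb c hc (by rw [hp₂' c hc hco, ← hbc, ((memA b).1 hb).1])
      rwa [hp₃ c hc]
    · obtain ⟨hcx, hco'⟩ := (memA c).1 hc
      exact absurd ((memA b).2 ⟨hbc.trans hcx, hlt.trans hco'⟩) hb
    · rwa [hp₃' b hb hbo, hp₃' c hc hco]

end Arrangement

/-- If `π` is an arrangement of `n ≤ w*d` objects in which stack `w+1` is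
empty, and `o` lies in stack `x`, then at most `2d + 2` permissible pop-and-push actions
transform `π` into an arrangement in which `o` is the top (minimal-depth) object of stack
`x`, every other object lies in the same stack as in `π`, and the relative order of the
objects other than `o` within each stack is unchanged. -/
theorem move_object_to_top (w d n : ℕ) (hw : 2 ≤ w) (hd : 1 ≤ d) (hn : n ≤ w * d)
    (π : Arrangement n (w + 1) d)
    (hempty : ∀ o : Fin n, ((π.pos o).1 : ℕ) < w)
    (o : Fin n) :
    ∃ m ≤ 2 * d + 2, ∃ π' : Arrangement n (w + 1) d,
      Reach π π' m ∧
      -- `o` is in the same stack `x` as before, at the top: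
      (π'.pos o).1 = (π.pos o).1 ∧
      (∀ o' : Fin n, o' ≠ o → (π'.pos o').1 = (π'.pos o).1 → (π'.pos o).2 < (π'.pos o').2) ∧
      -- every object other than `o` lies in the same stack as in `π`:
      (∀ o' : Fin n, o' ≠ o → (π'.pos o').1 = (π.pos o').1) ∧
      -- the relative order of the objects other than `o` within each stack is unchanged:
      (∀ o₁ o₂ : Fin n, o₁ ≠ o → o₂ ≠ o → (π.pos o₁).1 = (π.pos o₂).1 →
        (π.pos o₁).2 < (π.pos o₂).2 → (π'.pos o₁).2 < (π'.pos o₂).2) := by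
  classical
  set x := (π.pos o).1 with hx
  obtain ⟨y, hyw, hxy⟩ : ∃ y : Fin (w + 1), (y : ℕ) < w ∧ x ≠ y := by
    by_cases h : (x : ℕ) = 0
    · exact ⟨⟨1, by omega⟩, by simp; omega, fun h' => by simp [h'] at h⟩
    · exact ⟨⟨0, by omega⟩, by simp; omega, fun h' => by simp [h'] at h⟩
  have hye : y ≠ Fin.last w := fun h => by simp [h] at hyw
  have hne : ∀ b, (π.pos b).1 ≠ Fin.last w := fun b h => by simpa [h] using hempty b
  have hcard : (π.stack (Fin.last w)).card = 0 := by
    rw [Finset.card_eq_zero, Finset.eq_empty_iff_forall_notMem]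
    exact fun b hb => hne b (Arrangement.mem_stack.1 hb)
  by_cases hroom : (π.stack y).card < d
  · obtain ⟨m, hm, h⟩ :=
      π.exists_reach_top_of_room o hxy (hne o) hye hroom (by omega)
    exact ⟨m, by omega, h⟩
  -- Otherwise the top object `c` of the full stack `y` is parked on the empty stack meanwhile.
  obtain ⟨c, hc, hmin⟩ := (π.stack y).exists_min_image (fun b => (π.pos b).2)
    (Finset.card_pos.1 (by omega))
  rw [Arrangement.mem_stack] at hc
  have hctop : ∀ b, b ≠ c → (π.pos b).1 = y → (π.pos c).2 < (π.pos b).2 := fun b hbc hb =>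
    lt_of_le_of_ne (hmin b (Arrangement.mem_stack.2 hb)) fun h =>
      hbc (π.inj (Prod.ext (hb.trans hc.symm) h.symm))
  obtain ⟨ρ, s₁, hρc, hρ, -⟩ := Arrangement.exists_step (hne c)
    (fun b hbc hb => hctop b hbc (hb.trans hc)) (by omega)
  have hoc : o ≠ c := by
    rintro rfl
    exact hxy hc
  have hρo := hρ o hoc
  have hρlast : ∀ b, (ρ.pos b).1 = Fin.last w → b = c := by
    intro b hb
    by_contra hbc
    exact hne b (by rwa [hρ b hbc] at hb)
  have hρy : ∀ b, (ρ.pos b).1 = y → b ≠ c ∧ (π.pos b).1 = y := by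
    intro b hb
    have hbc : b ≠ c := by
      rintro rfl
      exact hye (hb.symm.trans hρc)
    exact ⟨hbc, by rwa [hρ b hbc] at hb⟩
  have hρroom : (ρ.stack y).card < d := by
    refine (Finset.card_lt_card (t := π.stack y) ?_).trans_le (π.card_stack_le y)
    refine (Finset.ssubset_iff_of_subset fun b hb => ?_).2
      ⟨c, Arrangement.mem_stack.2 hc, fun h => (hρy c (Arrangement.mem_stack.1 h)).1 rfl⟩
    exact Arrangement.mem_stack.2 (hρy b (Arrangement.mem_stack.1 hb)).2
  obtain ⟨m, hm, σ, r₂, hσo, hσtop, hσstack, hσord⟩ :=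
    ρ.exists_reach_top_of_room o (y := y) (e := Fin.last w)
      (by rwa [hρo]) (by rw [hρo]; exact hne o) hye hρroom
      (Finset.card_le_one.2 fun a ha b hb =>
        (hρlast a (Arrangement.mem_stack.1 ha)).trans
          (hρlast b (Arrangement.mem_stack.1 hb)).symm)
  have hσx : (σ.pos o).1 = x := by rw [hσo, hρo]
  have hσc : (σ.pos c).1 = Fin.last w := (hσstack c hoc.symm).trans hρc
  obtain ⟨τ, s₃, hτc, hτ, hτtop⟩ := Arrangement.exists_step (π := σ) (o := c) (j := y)
    (by rw [hσc]; exact hye.symm)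
    (by
      intro b hbc hb
      rw [hσc] at hb
      have hbo : b ≠ o := by
        rintro rfl
        exact hne b (hσx.symm.trans hb)
      exact absurd (hρlast b ((hσstack b hbo).symm.trans hb)) hbc)
    (by
      refine (Finset.card_le_card fun b hb => ?_).trans_lt hρroom
      rw [Arrangement.mem_stack] at hb ⊢
      have hbo : b ≠ o := by
        rintro rfl
        exact hxy (hσx.symm.trans hb)
      rwa [hσstack b hbo] at hb)
  have hstack : ∀ b, b ≠ o → (τ.pos b).1 = (π.pos b).1 := by
    intro b hbo
    by_cases hbc : b = c
    · rw [hbc, hτc, hc]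
    · rw [hτ b hbc, hσstack b hbo, hρ b hbc]
  refine ⟨1 + m + 1, by omega, τ, (s₁.reach.trans r₂).trans s₃.reach,
    by rw [hτ o hoc, hσx], ?_, hstack, ?_⟩
  · intro b hbo hb
    rw [hτ o hoc] at hb ⊢
    have hbc : b ≠ c := by
      rintro rfl
      exact hxy (hσx.symm.trans (hb.symm.trans hτc))
    rw [hτ b hbc] at hb ⊢
    exact hσtop b hbo hb
  · intro a b hao hbo hab hlt
    by_cases hbc : b = c
    · subst hbc
      have hac : a ≠ b := fun h => by simp [h] at hlt
      exact absurd (hctop a hac (hab.trans hc)) (not_lt.2 hlt.le)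
    · rw [hτ b hbc]
      by_cases hac : a = c
      · subst hac
        refine hτtop b hbc ?_
        rw [hσstack b hbo, hρ b hbc, ← hab, hc]
      · rw [hτ a hac]
        exact hσord a b hao hbo (by rwa [hρ a hac, hρ b hbc]) (by rwa [hρ a hac, hρ b hbc])
end

section
/- There exists a universal constant c > 0 such that for all integers w ≥ 2 and d ≥ 2, there exists an LSR instance (π_I, π_G) with n = wd objects whose every solution consists of at least c · w · d · (log d) / (log w) permissible pop-and-push actions. -/
@[ext]
theorem Arrangement.ext_pos {n k d : ℕ} {π ρ : Arrangement n k d} (h : π.pos = ρ.pos) : π = ρ := by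
  cases π
  cases ρ
  simp_all

/-- `StepVia i j π π'`: a permissible action takes `π` to `π'` by moving an object from stack `i`
to stack `j`. -/
def StepVia {n k d : ℕ} (i j : Fin k) (π π' : Arrangement n k d) : Prop :=
  ∃ o : Fin n, (π.pos o).1 = i ∧ (π'.pos o).1 = j ∧
    (∀ o' : Fin n, o' ≠ o → (π.pos o').1 = (π.pos o).1 → (π.pos o).2 < (π.pos o').2) ∧
    (∀ o' : Fin n, o' ≠ o → π'.pos o' = π.pos o')

theorem Step.exists_stepVia {n k d : ℕ} {π π' : Arrangement n k d} (h : Step π π') :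
    ∃ i j, StepVia i j π π' := by
  obtain ⟨o, -, htop, hrest⟩ := h
  exact ⟨_, _, o, rfl, rfl, htop, hrest⟩

/-- An object pushed onto a given stack cannot land at two different depths. -/
theorem Arrangement.not_depth_lt {n k d : ℕ} {ρ ρ' : Arrangement n k d} {o : Fin n}
    (hrest : ∀ o', o' ≠ o → ρ.pos o' = ρ'.pos o') (hstack : (ρ.pos o).1 = (ρ'.pos o).1) :
    ¬ (ρ.pos o).2 < (ρ'.pos o).2 := by
  intro hlt
  obtain ⟨o', ho'⟩ := ρ.contig o _ hlt.le
  have hne : o' ≠ o := by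
    rintro rfl
    rw [ho'] at hlt
    exact lt_irrefl _ hlt
  apply hne
  apply ρ'.inj
  rw [← hrest o' hne, ho', hstack]

/-- An action is determined by its source and target stacks. -/
theorem StepVia.unique {n k d : ℕ} {i j : Fin k} {π ρ ρ' : Arrangement n k d}
    (h : StepVia i j π ρ) (h' : StepVia i j π ρ') : ρ = ρ' := by
  obtain ⟨o, hi, hj, htop, hrest⟩ := h
  obtain ⟨p, hi', hj', htop', hrest'⟩ := h'
  obtain rfl : o = p := by
    by_contra hne
    exact lt_asymm (htop p (Ne.symm hne) (hi'.trans hi.symm)) (htop' o hne (hi.trans hi'.symm))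
  have hagree : ∀ o', o' ≠ o → ρ.pos o' = ρ'.pos o' := fun o' ho' =>
    (hrest o' ho').trans (hrest' o' ho').symm
  have hstack := hj.trans hj'.symm
  have hdepth : (ρ.pos o).2 = (ρ'.pos o).2 :=
    le_antisymm
      (not_lt.mp (Arrangement.not_depth_lt (fun o' ho' => (hagree o' ho').symm) hstack.symm))
      (not_lt.mp (Arrangement.not_depth_lt hagree hstack))
  ext1
  funext o'
  by_cases ho' : o' = o
  · subst ho'
    exact Prod.ext hstack hdepth
  · exact hagree o' ho'

open Classical in
/-- Perform the action with the given source and target stacks, or do nothing if the instruction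
is `none` or there is no such action. -/
noncomputable def Arrangement.act {n k d : ℕ} (π : Arrangement n k d) :
    Option (Fin k × Fin k) → Arrangement n k d
  | none => π
  | some (i, j) => if h : ∃ π', StepVia i j π π' then h.choose else π

theorem StepVia.act_eq {n k d : ℕ} {i j : Fin k} {π π' : Arrangement n k d}
    (h : StepVia i j π π') : π.act (some (i, j)) = π' := by
  have hex : ∃ π', StepVia i j π π' := ⟨π', h⟩
  simp only [Arrangement.act, dif_pos hex]
  exact hex.choose_spec.unique h

theorem Reach.exists_foldl_act {n k d : ℕ} {π π' : Arrangement n k d} {m M : ℕ}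
    (h : Reach π π' m) (hM : m ≤ M) :
    ∃ l : List.Vector (Option (Fin k × Fin k)) M, l.toList.foldl Arrangement.act π = π' := by
  induction M generalizing π m with
  | zero =>
    obtain ⟨f, h0, hm, -⟩ := h
    obtain rfl : m = 0 := by omega
    exact ⟨List.Vector.nil, by simp [← h0, ← hm]⟩
  | succ M ih =>
    cases m with
    | zero =>
      obtain ⟨l, hl⟩ := ih h (Nat.zero_le _)
      exact ⟨none ::ᵥ l, by simpa [Arrangement.act] using hl⟩
    | succ m =>
      obtain ⟨f, rfl, hm, hstep⟩ := h
      obtain ⟨i, j, hij⟩ := (hstep 0 (by omega)).exists_stepVia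
      have htail : Reach (f 1) π' m :=
        ⟨fun t => f (t + 1), rfl, hm, fun t ht => hstep (t + 1) (by omega)⟩
      obtain ⟨l, hl⟩ := ih htail (by omega)
      exact ⟨some (i, j) ::ᵥ l, by simpa [hij.act_eq] using hl⟩

/-- The arrangement filling the first `w` stacks, with objects labelled according to `σ`. -/
def Arrangement.ofPerm {w d : ℕ} (σ : Equiv.Perm (Fin (w * d))) :
    Arrangement (w * d) (w + 1) d where
  pos o := ((finProdFinEquiv.symm (σ o)).1.castSucc, (finProdFinEquiv.symm (σ o)).2)
  inj a b h := by
    rw [Prod.mk.injEq, Fin.castSucc_inj] at h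
    exact σ.injective (finProdFinEquiv.symm.injective (Prod.ext h.1 h.2))
  contig o j _ := by
    refine ⟨σ.symm (finProdFinEquiv ((finProdFinEquiv.symm (σ o)).1, j)), ?_⟩
    rw [Equiv.apply_symm_apply, Equiv.symm_apply_apply]

theorem Arrangement.ofPerm_injective {w d : ℕ} :
    Function.Injective (Arrangement.ofPerm (w := w) (d := d)) := by
  intro σ τ h
  ext1 o
  have ho : (ofPerm σ).pos o = (ofPerm τ).pos o := by rw [h]
  simp only [ofPerm, Prod.mk.injEq, Fin.castSucc_inj] at ho
  exact finProdFinEquiv.symm.injective (Prod.ext ho.1 ho.2)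

theorem factorial_le_of_forall_reach {w d M : ℕ} (π : Arrangement (w * d) (w + 1) d)
    (h : ∀ σ, ∃ m ≤ M, Reach π (Arrangement.ofPerm σ) m) :
    (w * d).factorial ≤ ((w + 1) * (w + 1) + 1) ^ M := by
  have hcode : ∀ σ, ∃ l : List.Vector (Option (Fin (w + 1) × Fin (w + 1))) M,
      l.toList.foldl Arrangement.act π = Arrangement.ofPerm σ := by
    intro σ
    obtain ⟨m, hm, hr⟩ := h σ
    exact hr.exists_foldl_act hm
  choose code hcode using hcode
  have hinj : Function.Injective code := fun σ τ hστ =>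
    Arrangement.ofPerm_injective (by rw [← hcode σ, ← hcode τ, hστ])
  simpa [Fintype.card_perm] using Fintype.card_le_of_injective code hinj

theorem pow_lt_factorial_mul {w d : ℕ} (hw : 2 ≤ w) (hd : 2 ≤ d) :
    d ^ (w * d - d) < (w * d).factorial := by
  have hle : 2 * d ≤ w * d := Nat.mul_le_mul_right d hw
  calc d ^ (w * d - d) < (d + 1) ^ (w * d - d) := Nat.pow_lt_pow_left (by omega) (by omega)
    _ ≤ d.factorial * (d + 1) ^ (w * d - d) := Nat.le_mul_of_pos_left _ d.factorial_pos
    _ ≤ (d + (w * d - d)).factorial := Nat.factorial_mul_pow_le_factorial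
    _ = (w * d).factorial := by congr 1; omega

/-- There is a universal constant `c > 0` such that for all `w ≥ 2`, `d ≥ 2`,
there exists an LSR instance with `n = w*d` objects whose every solution consists of at
least `c·w·d·(log d)/(log w)` permissible pop-and-push actions. -/
theorem lsr_log_lower_bound :
    ∃ c : ℝ, 0 < c ∧ ∀ w d : ℕ, 2 ≤ w → 2 ≤ d →
      ∃ πI πG : Arrangement (w * d) (w + 1) d,
        ∀ m : ℕ, Reach πI πG m →
          c * w * d * Real.log d / Real.log w ≤ (m : ℝ) := by
  refine ⟨1 / 8, by norm_num, fun w d hw hd => ⟨Arrangement.ofPerm 1, ?_⟩⟩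
  by_contra! hcon
  set B : ℝ := 1 / 8 * w * d * Real.log d / Real.log w with hB
  have hwR : (2 : ℝ) ≤ w := by exact_mod_cast hw
  have hdR : (2 : ℝ) ≤ d := by exact_mod_cast hd
  have hlogw : 0 < Real.log w := Real.log_pos (by linarith)
  have hlogd : 0 < Real.log d := Real.log_pos (by linarith)
  have hB0 : 0 ≤ B := by positivity
  have hcount : (w * d).factorial ≤ ((w + 1) * (w + 1) + 1) ^ ⌊B⌋₊ := by
    refine factorial_le_of_forall_reach (Arrangement.ofPerm 1) fun σ => ?_
    obtain ⟨m, hm, hlt⟩ := hcon (Arrangement.ofPerm σ)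
    exact ⟨m, Nat.le_floor hlt.le, hm⟩
  have hbase : (w + 1) * (w + 1) + 1 ≤ w ^ 4 := by nlinarith [Nat.mul_le_mul hw hw]
  have hlt : d ^ (w * d - d) < w ^ (4 * ⌊B⌋₊) :=
    calc d ^ (w * d - d) < (w * d).factorial := pow_lt_factorial_mul hw hd
      _ ≤ (w ^ 4) ^ ⌊B⌋₊ := hcount.trans (Nat.pow_le_pow_left hbase _)
      _ = w ^ (4 * ⌊B⌋₊) := (pow_mul w 4 _).symm
  have hlog : ((w * d - d : ℕ) : ℝ) * Real.log d < ((4 * ⌊B⌋₊ : ℕ) : ℝ) * Real.log w := by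
    rw [← Real.log_pow, ← Real.log_pow]
    exact Real.log_lt_log (by positivity) (by exact_mod_cast hlt)
  have hBlog : B * Real.log w = 1 / 8 * w * d * Real.log d := by
    rw [hB]
    field_simp
  rw [Nat.cast_sub (Nat.le_mul_of_pos_left d (by omega))] at hlog
  push_cast at hlog
  have hfloor : (⌊B⌋₊ : ℝ) * Real.log w ≤ B * Real.log w :=
    mul_le_mul_of_nonneg_right (Nat.floor_le hB0) hlogw.le
  have hdlog : 0 ≤ ((w : ℝ) - 2) * (d * Real.log d) :=
    mul_nonneg (by linarith) (by positivity)
  nlinarith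
end
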